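/- Let v, w : Fin 5 → ℙ(K^4) be tuples with the same rank matrix, π(v) = π(w). If the rank type of π(v) is none of (4,1,0), (5,1,0), (5,5,1), (5,8,1), (5,10,1), then v and w are in the same GL_4-orbit. -/

import Mathlib

open scoped LinearAlgebra.Projectivization

/-- The subspace of `Fin n → K` spanned by the lines `v i` for `i ∈ I`. -/
noncomputable def spanV {K : Type*} [Field K] {n m : ℕ}
    (v : Fin m → ℙ K (Fin n → K)) (I : Finset (Fin m)) : Submodule K (Fin n → K) :=
  ⨆ i ∈ I, (v i).submodule

/-- The rank matrix of a tuple of points in projective space. -/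
noncomputable def rankMatrix {K : Type*} [Field K] {n m : ℕ}
    (v : Fin m → ℙ K (Fin n → K)) (I : Finset (Fin m)) : ℕ :=
  Module.finrank K (spanV v I)

/-- `I` is an `r`-face of `φ`: maximal under inclusion with `φ I = r`. -/
def IsFace (φ : Finset (Fin 5) → ℕ) (r : ℕ) (I : Finset (Fin 5)) : Prop :=
  φ I = r ∧ ∀ J : Finset (Fin 5), I ⊆ J → φ J = r → J = I

/-- The rank type of `φ`: the numbers of 1-faces, 2-faces and 3-faces. -/
noncomputable def rankType (φ : Finset (Fin 5) → ℕ) : ℕ × ℕ × ℕ :=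
  ({I | IsFace φ 1 I}.ncard, {I | IsFace φ 2 I}.ncard, {I | IsFace φ 3 I}.ncard)

/-- Two tuples of points are in the same `GL_n`-orbit. -/
def SameOrbit {K : Type*} [Field K] {n m : ℕ}
    (v w : Fin m → ℙ K (Fin n → K)) : Prop :=
  ∃ g : (Fin n → K) ≃ₗ[K] (Fin n → K),
    ∀ i, w i = Projectivization.map g.toLinearMap g.injective (v i)


/-! ### Combinatorics of rank functions on five elements -/

instance isFaceDecidable (φ : Finset (Fin 5) → ℕ) (r : ℕ) : DecidablePred (IsFace φ r) := by
  intro I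
  unfold IsFace
  infer_instance

/-- A computable version of the rank type. -/
def rankTypeC (φ : Finset (Fin 5) → ℕ) : ℕ × ℕ × ℕ :=
  ((Finset.univ.filter (IsFace φ 1)).card, (Finset.univ.filter (IsFace φ 2)).card,
    (Finset.univ.filter (IsFace φ 3)).card)

lemma rankType_eq_rankTypeC (φ : Finset (Fin 5) → ℕ) : rankType φ = rankTypeC φ := by
  have key : ∀ r, {I | IsFace φ r I}.ncard = (Finset.univ.filter (IsFace φ r)).card := by
    intro r
    rw [← Set.ncard_coe_finset]
    congr 1
    ext I
    simp
  simp only [rankType, rankTypeC, key]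

/-- The model rank function: rank `r`, uniform except that `T` has rank at most `r - 1`. -/
def modelRank (r : ℕ) (T I : Finset (Fin 5)) : ℕ :=
  if I ⊆ T then min (r - 1) I.card else min r I.card

set_option maxRecDepth 100000 in
lemma modelRank_two : ∀ T : Finset (Fin 5), T.card ≤ 2 →
    rankTypeC (modelRank 2 T) ∈ ([(4,1,0), (5,1,0)] : List (ℕ × ℕ × ℕ)) := by
  decide +kernel

set_option maxRecDepth 100000 in
lemma modelRank_three : ∀ T : Finset (Fin 5), T.card ≤ 4 →
    rankTypeC (modelRank 3 T) ∈ ([(5,5,1), (5,8,1), (5,10,1)] : List (ℕ × ℕ × ℕ)) := by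
  decide +kernel

/-- The axioms of a loopless matroid rank function. -/
structure IsRk (φ : Finset (Fin 5) → ℕ) : Prop where
  single : ∀ i, φ {i} = 1
  mono : ∀ I J, I ⊆ J → φ I ≤ φ J
  submod : ∀ I J, φ (I ∪ J) + φ (I ∩ J) ≤ φ I + φ J
  le_card : ∀ I, φ I ≤ I.card

lemma IsRk.of_subset {φ : Finset (Fin 5) → ℕ} (h : IsRk φ) {I J : Finset (Fin 5)} (hIJ : I ⊆ J)
    (hJ : φ J = J.card) : φ I = I.card := by
  have h1 := h.submod I (J \ I)
  rw [Finset.union_sdiff_of_subset hIJ, hJ] at h1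
  have h2 := h.le_card (J \ I)
  have h3 := h.le_card I
  have h4 := Finset.card_sdiff_add_card_eq_card hIJ
  omega

lemma five_cover (b c j k x y : Fin 5) (h : [b, c, j, k, x].Nodup) :
    y = b ∨ y = c ∨ y = j ∨ y = k ∨ y = x := by
  simp at h
  omega

lemma rank_three_excluded {φ : Finset (Fin 5) → ℕ} (h : IsRk φ) (hu : φ Finset.univ = 3)
    (x : Fin 5) (hx : ∀ I : Finset (Fin 5), x ∈ I → I.card = 3 → φ I = 3) :
    rankType φ ∈ ({(4,1,0), (5,1,0), (5,5,1), (5,8,1), (5,10,1)} : Set (ℕ × ℕ × ℕ)) := by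
  have hle : ∀ I, φ I ≤ 3 := fun I => hu ▸ h.mono _ _ (Finset.subset_univ _)
  -- small sets are independent
  have hsmall : ∀ I : Finset (Fin 5), I.card ≤ 2 → φ I = I.card := by
    intro I hI
    obtain ⟨J, hJ1, -, hJ2⟩ := Finset.exists_subsuperset_card_eq (n := 3)
      (Finset.subset_univ (insert x I))
      (by have := Finset.card_insert_le x I; omega) (by simp)
    exact h.of_subset ((Finset.subset_insert _ _).trans hJ1)
      (by rw [hx J (hJ1 (Finset.mem_insert_self _ _)) hJ2, hJ2])
  have hbig2 : ∀ I : Finset (Fin 5), 2 ≤ I.card → 2 ≤ φ I := by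
    intro I hI
    obtain ⟨J, hJ1, hJ2⟩ := Finset.exists_subset_card_eq hI
    have := h.mono _ _ hJ1
    rw [hsmall J (by omega)] at this
    omega
  have hbig3 : ∀ I : Finset (Fin 5), x ∈ I → 3 ≤ I.card → φ I = 3 := by
    intro I hxI hI
    obtain ⟨J, hJ1, hJ2, hJ3⟩ := Finset.exists_subsuperset_card_eq (n := 3)
      (Finset.singleton_subset_iff.2 hxI) (by simp) hI
    have := h.mono _ _ hJ2
    rw [hx J (by simpa using hJ1) hJ3] at this
    have := hle I
    omega
  obtain ⟨T, hT, hφ⟩ : ∃ T : Finset (Fin 5), T.card ≤ 4 ∧ φ = modelRank 3 T := by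
    have hc : ({x}ᶜ : Finset (Fin 5)).card = 4 := by simp [Finset.card_compl]
    by_cases h2 : φ {x}ᶜ = 2
    · refine ⟨{x}ᶜ, by omega, funext fun I => ?_⟩
      unfold modelRank
      split_ifs with hI
      · have h3 := h.mono _ _ hI
        rcases le_total I.card 2 with h4 | h4
        · rw [hsmall I h4]; omega
        · have := hbig2 I h4; omega
      · have hxI : x ∈ I := by
          by_contra hxI
          exact hI (by intro y hy; simp; rintro rfl; exact hxI hy)
        rcases le_total I.card 2 with h4 | h4
        · rw [hsmall I h4]; omega
        · by_cases h5 : I.card = 2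
          · rw [hsmall I h5.le]; omega
          · rw [hbig3 I hxI (by omega)]; omega
    · have h3 : φ {x}ᶜ = 3 := by
        have := hbig2 {x}ᶜ (by omega); have := hle {x}ᶜ; omega
      by_cases hT : ∃ T : Finset (Fin 5), T.card = 3 ∧ φ T = 2
      · obtain ⟨T, hT1, hT2⟩ := hT
        refine ⟨T, by omega, funext fun I => ?_⟩
        unfold modelRank
        by_cases h4 : I.card ≤ 2
        · rw [hsmall I h4]; split_ifs <;> omega
        split_ifs with hI
        · have := h.mono _ _ hI
          have := hbig2 I (by omega)
          omega
        · have hgoal : φ I = 3 := by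
            by_cases hxI : x ∈ I
            · exact hbig3 I hxI (by omega)
            by_contra hne
            have h5 : φ I = 2 := by
              have := hbig2 I (by omega); have := hle I; omega
            have hxT : x ∉ T := fun hh => by have := hx T hh hT1; omega
            have hIT := h.submod I T
            have e1 : I ∪ T = {x}ᶜ := by
              apply Finset.eq_of_subset_of_card_le
              · intro y hy
                simp at hy ⊢
                rintro rfl
                tauto
              · by_contra hlt
                have h7 : (I ∪ T).card ≤ T.card := by omega
                have := Finset.eq_of_subset_of_card_le Finset.subset_union_right h7
                exact hI (by rw [this]; exact Finset.subset_union_left)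
            have e2 := Finset.card_union_add_card_inter I T
            rw [e1] at hIT e2
            have := hbig2 (I ∩ T) (by omega)
            omega
          omega
      · push Not at hT
        refine ⟨∅, by simp, funext fun I => ?_⟩
        unfold modelRank
        by_cases h4 : I.card ≤ 2
        · rw [hsmall I h4]
          split_ifs with hI
          · have := Finset.subset_empty.1 hI; simp [this]
          · omega
        have hI : ¬ I ⊆ ∅ := by
          intro hI
          have := Finset.subset_empty.1 hI
          simp [this] at h4
        rw [if_neg hI]
        obtain ⟨J, hJ1, hJ2⟩ := Finset.exists_subset_card_eq (show 3 ≤ I.card by omega)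
        have := hT J hJ2
        have := hbig2 J (by omega)
        have := h.mono _ _ hJ1
        have := hle I
        omega
  have := modelRank_three T hT
  rw [rankType_eq_rankTypeC, hφ]
  simp only [List.mem_cons, List.not_mem_nil, or_false] at this
  simp only [Set.mem_insert_iff, Set.mem_singleton_iff]
  tauto

lemma rank_two_excluded {φ : Finset (Fin 5) → ℕ} (h : IsRk φ) (hu : φ Finset.univ = 2)
    (x : Fin 5) (hx : ∀ I : Finset (Fin 5), x ∉ I → I.card = 2 → φ I = 2) :
    rankType φ ∈ ({(4,1,0), (5,1,0), (5,5,1), (5,8,1), (5,10,1)} : Set (ℕ × ℕ × ℕ)) := by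
  have hle : ∀ I, φ I ≤ 2 := fun I => hu ▸ h.mono _ _ (Finset.subset_univ _)
  have h0 : φ ∅ = 0 := by have := h.le_card ∅; simpa using this
  have h1 : ∀ I : Finset (Fin 5), I.card = 1 → φ I = 1 := by
    intro I hI
    obtain ⟨i, rfl⟩ := Finset.card_eq_one.1 hI
    exact h.single i
  have hpos : ∀ I : Finset (Fin 5), 1 ≤ I.card → 1 ≤ φ I := by
    intro I hI
    obtain ⟨J, hJ1, hJ2⟩ := Finset.exists_subset_card_eq hI
    have := h.mono _ _ hJ1
    rw [h1 J hJ2] at this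
    omega
  -- sets with three elements have rank two
  have h3 : ∀ I : Finset (Fin 5), 3 ≤ I.card → φ I = 2 := by
    intro I hI
    have h4 := Finset.pred_card_le_card_erase (a := x) (s := I)
    obtain ⟨J, hJ1, hJ2⟩ := Finset.exists_subset_card_eq (show 2 ≤ (I.erase x).card by omega)
    have := hx J (fun hh => by simpa using hJ1 hh) hJ2
    have := h.mono _ _ (hJ1.trans (Finset.erase_subset _ _))
    have := hle I
    omega
  obtain ⟨T, hT, hφ⟩ : ∃ T : Finset (Fin 5), T.card ≤ 2 ∧ φ = modelRank 2 T := by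
    by_cases hT : ∃ T : Finset (Fin 5), T.card = 2 ∧ φ T = 1
    · obtain ⟨T, hT1, hT2⟩ := hT
      refine ⟨T, by omega, funext fun I => ?_⟩
      unfold modelRank
      rcases Nat.eq_zero_or_pos I.card with hc | hc
      · rw [Finset.card_eq_zero.1 hc, h0]; simp
      split_ifs with hI
      · have := h.mono _ _ hI
        have := hpos I hc
        omega
      · by_cases hc1 : I.card = 1
        · rw [h1 I hc1]; omega
        · by_cases hc3 : 3 ≤ I.card
          · rw [h3 I hc3]; omega
          have hgoal : φ I = 2 := by
            by_contra hne
            have h5 : φ I = 1 := by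
              have := hpos I hc; have := hle I; omega
            have hxT : x ∈ T := by
              by_contra hh
              have := hx T hh hT1; omega
            have hxI : x ∈ I := by
              by_contra hh
              have := hx I hh (by omega); omega
            have hIT := h.submod I T
            have h6 := hpos (I ∩ T) (Finset.card_pos.2 ⟨x, by simp [hxT, hxI]⟩)
            have h7 : 3 ≤ (I ∪ T).card := by
              by_contra hlt
              have h7 : (I ∪ T).card ≤ T.card := by omega
              have := Finset.eq_of_subset_of_card_le Finset.subset_union_right h7
              exact hI (by rw [this]; exact Finset.subset_union_left)
            have := h3 _ h7
            omega
          omega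
    · push Not at hT
      refine ⟨∅, by simp, funext fun I => ?_⟩
      unfold modelRank
      rcases Nat.eq_zero_or_pos I.card with hc | hc
      · rw [Finset.card_eq_zero.1 hc, h0]; simp
      have hI : ¬ I ⊆ ∅ := by
        intro hI
        have := Finset.subset_empty.1 hI
        simp [this] at hc
      rw [if_neg hI]
      by_cases hc1 : I.card = 1
      · rw [h1 I hc1]; omega
      obtain ⟨J, hJ1, hJ2⟩ := Finset.exists_subset_card_eq (show 2 ≤ I.card by omega)
      have := hT J hJ2
      have := hpos J (by omega)
      have := h.mono _ _ hJ1
      have := hle I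
      omega
  have := modelRank_two T hT
  rw [rankType_eq_rankTypeC, hφ]
  simp only [List.mem_cons, List.not_mem_nil, or_false] at this
  simp only [Set.mem_insert_iff, Set.mem_singleton_iff]
  tauto

/-- If a matroid of rank two or three on five elements has a `U_{2,4}`-minor obtained from the
basis `B`, then its rank type is excluded. -/
lemma excluded_of_bad {φ : Finset (Fin 5) → ℕ} (h : IsRk φ) {B : Finset (Fin 5)}
    (hB : φ B = B.card) (hu : φ Finset.univ = B.card) {b c j k : Fin 5}
    (hb : b ∈ B) (hc : c ∈ B) (hj : j ∉ B) (hk : k ∉ B) (hbc : b ≠ c) (hjk : j ≠ k)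
    (hjb : φ (insert j (B.erase b)) = B.card) (hjc : φ (insert j (B.erase c)) = B.card)
    (hkb : φ (insert k (B.erase b)) = B.card) (hkc : φ (insert k (B.erase c)) = B.card)
    (hd : φ (insert k ((insert j (B.erase b)).erase c)) = B.card) :
    rankType φ ∈ ({(4,1,0), (5,1,0), (5,5,1), (5,8,1), (5,10,1)} : Set (ℕ × ℕ × ℕ)) := by
  have hbj : b ≠ j := by rintro rfl; exact hj hb
  have hbk : b ≠ k := by rintro rfl; exact hk hb
  have hcj : c ≠ j := by rintro rfl; exact hj hc
  have hck : c ≠ k := by rintro rfl; exact hk hc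
  obtain ⟨x, hx⟩ : ∃ x : Fin 5, [b, c, j, k, x].Nodup := by
    have : (({b, c, j, k} : Finset (Fin 5))ᶜ).Nonempty := by
      rw [← Finset.card_pos, Finset.card_compl]
      have := Finset.card_le_four (a := b) (b := c) (c := j) (d := k)
      simp
      omega
    obtain ⟨x, hx⟩ := this
    refine ⟨x, ?_⟩
    simp at hx ⊢
    refine ⟨⟨hbc, hbj, hbk, ?_⟩, ⟨hcj, hck, ?_⟩, ⟨hjk, ?_⟩, ?_⟩ <;> grind
  have hcov := fun y => five_cover b c j k x y hx
  simp at hx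
  by_cases hxB : x ∈ B
  · have eB : B = {b, c, x} := by
      ext y; have := hcov y; simp; grind
    subst eB
    have hcard : ({b, c, x} : Finset (Fin 5)).card = 3 :=
      Finset.card_eq_three.2 ⟨b, c, x, by grind, by grind, by grind, rfl⟩
    rw [hcard] at hB hu hjb hjc hkb hkc hd
    apply rank_three_excluded h hu x
    intro I hxI hI
    have e : ∃ y z, y ≠ z ∧ y ≠ x ∧ z ≠ x ∧ I = {y, z, x} := by
      have : (I.erase x).card = 2 := by rw [Finset.card_erase_of_mem hxI]; omega
      obtain ⟨y, z, hyz, hh⟩ := Finset.card_eq_two.1 this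
      refine ⟨y, z, hyz, ?_, ?_, ?_⟩
      · have : y ∈ I.erase x := by simp [hh]
        exact Finset.ne_of_mem_erase this
      · have : z ∈ I.erase x := by simp [hh]
        exact Finset.ne_of_mem_erase this
      · rw [← Finset.insert_erase hxI, hh]; ext; simp; tauto
    obtain ⟨y, z, hyz, hyx, hzx, rfl⟩ := e
    have e1 : insert j (({b, c, x} : Finset (Fin 5)).erase b) = {c, j, x} := by ext; simp; grind
    have e2 : insert j (({b, c, x} : Finset (Fin 5)).erase c) = {b, j, x} := by ext; simp; grind
    have e3 : insert k (({b, c, x} : Finset (Fin 5)).erase b) = {c, k, x} := by ext; simp; grind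
    have e4 : insert k (({b, c, x} : Finset (Fin 5)).erase c) = {b, k, x} := by ext; simp; grind
    have e5 : insert k ((insert j (({b, c, x} : Finset (Fin 5)).erase b)).erase c) = {j, k, x} := by
      ext; simp; grind
    rw [e1] at hjb
    rw [e2] at hjc
    rw [e3] at hkb
    rw [e4] at hkc
    rw [e5] at hd
    have hcomm : ∀ y z : Fin 5, ({y, z, x} : Finset (Fin 5)) = {z, y, x} :=
      fun y z => Finset.insert_comm _ _ _
    rcases hcov y with rfl | rfl | rfl | rfl | rfl <;>
    rcases hcov z with rfl | rfl | rfl | rfl | rfl <;>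
    first
      | exact absurd rfl hyz
      | exact absurd rfl hyx
      | exact absurd rfl hzx
      | assumption
      | (rw [hcomm]; assumption)
  · have eB : B = {b, c} := by
      ext y; have := hcov y; simp; grind
    subst eB
    have hcard : ({b, c} : Finset (Fin 5)).card = 2 := Finset.card_pair hbc
    rw [hcard] at hB hu hjb hjc hkb hkc hd
    apply rank_two_excluded h hu x
    intro I hxI hI
    obtain ⟨y, z, hyz, rfl⟩ := Finset.card_eq_two.1 hI
    have hyx : y ≠ x := by rintro rfl; simp at hxI
    have hzx : z ≠ x := by rintro rfl; simp at hxI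
    have e1 : insert j (({b, c} : Finset (Fin 5)).erase b) = {c, j} := by ext; simp; grind
    have e2 : insert j (({b, c} : Finset (Fin 5)).erase c) = {b, j} := by ext; simp; grind
    have e3 : insert k (({b, c} : Finset (Fin 5)).erase b) = {c, k} := by ext; simp; grind
    have e4 : insert k (({b, c} : Finset (Fin 5)).erase c) = {b, k} := by ext; simp; grind
    have e5 : insert k ((insert j (({b, c} : Finset (Fin 5)).erase b)).erase c) = {j, k} := by
      ext; simp; grind
    rw [e1] at hjb
    rw [e2] at hjc
    rw [e3] at hkb
    rw [e4] at hkc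
    rw [e5] at hd
    have hcomm : ∀ y z : Fin 5, ({y, z} : Finset (Fin 5)) = {z, y} :=
      fun y z => Finset.pair_comm _ _
    rcases hcov y with rfl | rfl | rfl | rfl | rfl <;>
    rcases hcov z with rfl | rfl | rfl | rfl | rfl <;>
    first
      | exact absurd rfl hyz
      | exact absurd rfl hyx
      | exact absurd rfl hzx
      | assumption
      | (rw [hcomm]; assumption)

/-! ### Scaling of matrices -/

/-- Two matrices with the same support, supported in two rows, whose full `2 × 2` submatrices are
singular, differ by a scaling of rows and columns. -/
lemma scale_rows {K ι : Type*} [Field K] (a a' : ι → ι → K)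
    (hs : ∀ i b, a i b = 0 ↔ a' i b = 0)
    (hm : ∀ i l b c, i ≠ l → b ≠ c → a i b ≠ 0 → a i c ≠ 0 → a l b ≠ 0 → a l c ≠ 0 →
      a i b * a l c = a i c * a l b)
    (hm' : ∀ i l b c, i ≠ l → b ≠ c → a' i b ≠ 0 → a' i c ≠ 0 → a' l b ≠ 0 → a' l c ≠ 0 →
      a' i b * a' l c = a' i c * a' l b)
    (j k : ι) (hjk : j ≠ k) (h0 : ∀ i, i ≠ j → i ≠ k → ∀ b, a i b = 0) :
    ∃ s t : ι → K, (∀ i, s i ≠ 0) ∧ (∀ b, t b ≠ 0) ∧ ∀ i b, a' i b = s i * a i b * t b := by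
  classical
  obtain ⟨n, hn, hnn⟩ : ∃ n : K, n ≠ 0 ∧ ∀ b, a j b ≠ 0 → a k b ≠ 0 →
      a' k b * a j b = n * (a k b * a' j b) := by
    by_cases hex : ∃ b, a j b ≠ 0 ∧ a k b ≠ 0
    · obtain ⟨b, hj, hk⟩ := hex
      have hj' : a' j b ≠ 0 := fun hh => hj ((hs _ _).2 hh)
      have hk' : a' k b ≠ 0 := fun hh => hk ((hs _ _).2 hh)
      refine ⟨a' k b * a j b / (a k b * a' j b), by positivity, ?_⟩
      intro c hjc hkc
      have hjc' : a' j c ≠ 0 := fun hh => hjc ((hs _ _).2 hh)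
      have hkc' : a' k c ≠ 0 := fun hh => hkc ((hs _ _).2 hh)
      by_cases hbc : b = c
      · subst hbc; field_simp
      have e1 := hm j k b c hjk hbc hj hjc hk hkc
      have e2 := hm' j k b c hjk hbc hj' hjc' hk' hkc'
      rw [div_mul_eq_mul_div, eq_div_iff (by positivity)]
      linear_combination (a' k c * a' j b) * (-e1) + (a j b * a k c) * e2
    · push Not at hex
      exact ⟨1, one_ne_zero, fun b h1 h2 => absurd (hex b h1) h2⟩
  refine ⟨fun i => if i = k then n else 1, fun b => if a j b ≠ 0 then a' j b / a j b else
    if a k b ≠ 0 then a' k b / (n * a k b) else 1, ?_, ?_, ?_⟩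
  · intro i; dsimp only; split_ifs <;> simp [hn]
  · intro b
    dsimp only
    split_ifs with h1 h2
    · exact div_ne_zero (fun hh => h1 ((hs _ _).2 hh)) h1
    · exact div_ne_zero (fun hh => h2 ((hs _ _).2 hh)) (mul_ne_zero hn h2)
    · exact one_ne_zero
  · intro i b
    dsimp only
    by_cases hab : a i b = 0
    · rw [hab, (hs i b).1 hab]; simp
    by_cases hij : i = j
    · subst hij
      rw [if_neg hjk, if_pos hab]
      field_simp
    by_cases hik : i = k
    · subst hik
      rw [if_pos rfl]
      by_cases h1 : a j b = 0
      · rw [if_neg (by simpa using h1), if_pos hab]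
        field_simp
      · rw [if_pos h1]
        have := hnn b h1 hab
        field_simp
        linear_combination this
    · exact absurd (h0 i hij hik b) hab

/-! ### Linear algebra -/

section LinAlg

variable {K V ι : Type*} [Field K] [AddCommGroup V] [Module K V] [DecidableEq ι]

/-- Expression of `p j` in terms of a swapped family. -/
lemma swap_indep {p : ι → V} {B : Finset ι} (hB : LinearIndepOn K p (B : Set ι)) {j b : ι}
    (hj : j ∉ B) (hb : b ∈ B) (a : ι → K) (ha : p j = ∑ x ∈ B, a x • p x) :
    a b ≠ 0 ↔ LinearIndepOn K p ((insert j (B.erase b) : Finset ι) : Set ι) := by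
  have hj' : j ∉ B.erase b := fun hh => hj (Finset.mem_of_mem_erase hh)
  rw [linearIndepOn_finset_iff] at hB ⊢
  constructor
  · intro hab f hf
    rw [Finset.sum_insert hj', ha] at hf
    have h1 : ∑ x ∈ B, (f j * a x + if x = b then 0 else f x) • p x = 0 := by
      rw [← hf, Finset.smul_sum]
      simp only [add_smul, Finset.sum_add_distrib, mul_smul]
      congr 1
      rw [← Finset.add_sum_erase _ _ hb]
      simp only [if_true, zero_smul, zero_add]
      apply Finset.sum_congr rfl
      intro x hx
      rw [if_neg (Finset.ne_of_mem_erase hx)]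
    have h2 := hB _ h1
    have h3 : f j = 0 := by
      have := h2 b hb
      simpa [hab] using this
    intro x hx
    rcases Finset.mem_insert.1 hx with rfl | hx
    · exact h3
    · have := h2 x (Finset.mem_of_mem_erase hx)
      simpa [h3, Finset.ne_of_mem_erase hx] using this
  · intro hf hab
    have h1 := hf (fun x => if x = j then -1 else a x) ?_ j (Finset.mem_insert_self _ _)
    · simp at h1
    · rw [Finset.sum_insert hj', ha, ← Finset.add_sum_erase _ _ hb, hab]
      simp only [if_true, zero_smul, zero_add, neg_smul, one_smul]
      rw [neg_add_eq_zero]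
      apply Finset.sum_congr rfl
      intro x hx
      rw [if_neg (by rintro rfl; exact hj' hx)]

lemma double_swap_indep {p : ι → V} {B : Finset ι} (hB : LinearIndepOn K p (B : Set ι))
    {j k b c : ι} (hj : j ∉ B) (hk : k ∉ B) (hb : b ∈ B) (hc : c ∈ B) (hjk : j ≠ k) (hbc : b ≠ c)
    (a a' : ι → K) (ha : p j = ∑ x ∈ B, a x • p x) (ha' : p k = ∑ x ∈ B, a' x • p x)
    (hab : a b ≠ 0) (hm : a b * a' c ≠ a c * a' b) :
    LinearIndepOn K p ((insert k ((insert j (B.erase b)).erase c) : Finset ι) : Set ι) := by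
  have hj' : j ∉ B.erase b := fun hh => hj (Finset.mem_of_mem_erase hh)
  have h1 := (swap_indep hB hj hb a ha).1 hab
  have hcj : c ≠ j := by rintro rfl; exact hj hc
  refine (swap_indep h1 (j := k) (b := c) ?_ ?_
    (fun x => if x = j then a' b / a b else a' x - a' b / a b * a x) ?_).1 ?_
  · simp [hjk.symm, hk]
  · simp [hc, hbc.symm]
  · rw [Finset.sum_insert hj', ha, ha']
    simp only [if_true]
    have e : ∑ x ∈ B.erase b, (if x = j then a' b / a b else a' x - a' b / a b * a x) • p x =
        ∑ x ∈ B, (a' x - a' b / a b * a x) • p x := by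
      rw [← Finset.add_sum_erase B _ hb]
      have : a' b - a' b / a b * a b = 0 := by field_simp; ring
      rw [this, zero_smul, zero_add]
      apply Finset.sum_congr rfl
      intro x hx
      rw [if_neg (by rintro rfl; exact hj' hx)]
    rw [e, Finset.smul_sum, ← Finset.sum_add_distrib]
    apply Finset.sum_congr rfl
    intro x _
    rw [smul_smul, ← add_smul]
    congr 1
    ring
  · rw [if_neg hcj]
    intro hh
    apply hm
    field_simp at hh
    linear_combination hh

/-- Two linearly independent families are related by a linear automorphism. -/
lemma exists_equiv [FiniteDimensional K V] {B : Finset ι} {p q : ι → V}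
    (hp : LinearIndepOn K p (B : Set ι)) (hq : LinearIndepOn K q (B : Set ι)) :
    ∃ g : V ≃ₗ[K] V, ∀ b ∈ B, g (p b) = q b := by
  let e := (Module.Basis.span hp).equiv (Module.Basis.span hq) (Equiv.refl _)
  obtain ⟨g, hg⟩ := Submodule.exists_linearEquiv_restrict_eq e
  refine ⟨g, fun b hb => ?_⟩
  have h1 := hg (Module.Basis.span hp ⟨b, hb⟩)
  simp only [e, Module.Basis.equiv_apply, Equiv.refl_apply] at h1
  have h2 : ((Module.Basis.span hp ⟨b, hb⟩ : Submodule.span K _) : V) = p b :=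
    congrArg Subtype.val (Module.Basis.span_apply hp ⟨b, hb⟩)
  have h3 : ((Module.Basis.span hq ⟨b, hb⟩ : Submodule.span K _) : V) = q b :=
    congrArg Subtype.val (Module.Basis.span_apply hq ⟨b, hb⟩)
  rw [← h2, ← h3]
  exact h1.symm

end LinAlg

/-! ### Rank matrices -/

section Ranks

variable {K : Type*} [Field K] (v : Fin 5 → ℙ K (Fin 4 → K))

lemma spanV_eq (I : Finset (Fin 5)) :
    spanV v I = Submodule.span K ((fun i => (v i).rep) '' (I : Set (Fin 5))) := by
  unfold spanV
  simp only [Projectivization.submodule_eq]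
  rw [Set.image_eq_iUnion, Submodule.span_iUnion₂]
  rfl

lemma indep_iff (I : Finset (Fin 5)) :
    LinearIndepOn K (fun i => (v i).rep) (I : Set (Fin 5)) ↔ rankMatrix v I = I.card := by
  unfold LinearIndepOn
  rw [linearIndependent_iff_card_eq_finrank_span, rankMatrix, spanV_eq, Set.finrank]
  have : Set.range (fun x : (I : Set (Fin 5)) => (v x).rep) =
      (fun i => (v i).rep) '' (I : Set (Fin 5)) := by
    rw [Set.image_eq_range]
  rw [this]
  simp only [Finset.coe_sort_coe, Fintype.card_coe]
  exact eq_comm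

lemma spanV_union (I J : Finset (Fin 5)) : spanV v (I ∪ J) = spanV v I ⊔ spanV v J := by
  rw [spanV_eq, spanV_eq, spanV_eq, Finset.coe_union, Set.image_union, Submodule.span_union]

lemma spanV_mono {I J : Finset (Fin 5)} (h : I ⊆ J) : spanV v I ≤ spanV v J := by
  rw [spanV_eq, spanV_eq]
  exact Submodule.span_mono (Set.image_mono (by exact_mod_cast h))

lemma isRk_rankMatrix : IsRk (rankMatrix v) where
  single i := by
    have e : spanV v {i} = (v i).submodule := by simp [spanV]
    rw [rankMatrix, e]
    exact Projectivization.finrank_submodule _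
  mono I J h := Submodule.finrank_mono (spanV_mono v h)
  submod I J := by
    unfold rankMatrix
    rw [← Submodule.finrank_sup_add_finrank_inf_eq (spanV v I) (spanV v J), spanV_union]
    apply Nat.add_le_add_left
    exact Submodule.finrank_mono
      (le_inf (spanV_mono v Finset.inter_subset_left) (spanV_mono v Finset.inter_subset_right))
  le_card I := by
    unfold rankMatrix
    rw [spanV_eq]
    classical
    have := finrank_span_finset_le_card (R := K) (I.image (fun i => (v i).rep))
    rw [Set.finrank, Finset.coe_image] at this
    exact this.trans Finset.card_image_le

/-- A basis of the tuple. -/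
lemma exists_basis : ∃ B : Finset (Fin 5), rankMatrix v B = B.card ∧
    rankMatrix v Finset.univ = B.card := by
  classical
  obtain ⟨b, -, -, h1, h2⟩ := exists_linearIndepOn_extension (K := K) (v := fun i => (v i).rep)
    (linearIndepOn_empty K _) (Set.empty_subset Set.univ)
  have hb : ((b.toFinset : Finset (Fin 5)) : Set (Fin 5)) = b := by simp
  refine ⟨b.toFinset, ?_, ?_⟩
  · rw [← indep_iff, hb]; exact h2
  · have h3 := (indep_iff v b.toFinset).1 (by rw [hb]; exact h2)
    rw [← h3, rankMatrix, rankMatrix]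
    suffices e : spanV v Finset.univ = spanV v b.toFinset by rw [e]
    rw [spanV_eq, spanV_eq, hb, Finset.coe_univ]
    apply le_antisymm
    · exact Submodule.span_le.2 h1
    · exact Submodule.span_mono (Set.image_mono (Set.subset_univ _))

/-- The coordinates of a tuple in a basis. -/
lemma exists_coords {B : Finset (Fin 5)} (hB : rankMatrix v B = B.card)
    (hu : rankMatrix v Finset.univ = B.card)
    (ht : rankType (rankMatrix v) ∉
      ({(4,1,0), (5,1,0), (5,5,1), (5,8,1), (5,10,1)} : Set (ℕ × ℕ × ℕ))) :
    ∃ a : Fin 5 → Fin 5 → K,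
      (∀ j, j ∉ B → (v j).rep = ∑ x ∈ B, a j x • (v x).rep) ∧
      (∀ j b, a j b ≠ 0 ↔
        j ∉ B ∧ b ∈ B ∧ rankMatrix v (insert j (B.erase b)) = B.card) ∧
      (∀ i l b c, i ≠ l → b ≠ c → a i b ≠ 0 → a i c ≠ 0 → a l b ≠ 0 → a l c ≠ 0 →
        a i b * a l c = a i c * a l b) := by
  classical
  have hind := (indep_iff v B).2 hB
  have hspan : spanV v B = spanV v Finset.univ := by
    apply Submodule.eq_of_le_of_finrank_eq (spanV_mono v (Finset.subset_univ _))
    exact hB.trans hu.symm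
  have hmem : ∀ j, ∃ f : Fin 5 → K, (v j).rep = ∑ x ∈ B, f x • (v x).rep := by
    intro j
    have h1 : (v j).rep ∈ spanV v B := by
      rw [hspan, spanV_eq]
      exact Submodule.subset_span ⟨j, by simp, rfl⟩
    rw [spanV_eq, Submodule.mem_span_image_finset_iff_exists_fun] at h1
    obtain ⟨f, hf⟩ := h1
    refine ⟨fun x => if hx : x ∈ B then f ⟨x, hx⟩ else 0, ?_⟩
    rw [← hf, ← Finset.sum_attach B]
    apply Finset.sum_congr rfl
    intro x _
    simp
  choose f hf using hmem
  have hcard : ∀ j b, j ∉ B → b ∈ B → (insert j (B.erase b)).card = B.card := by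
    intro j b hj hb
    rw [Finset.card_insert_of_notMem (fun hh => hj (Finset.mem_of_mem_erase hh)),
      Finset.card_erase_add_one hb]
  have hsupp : ∀ j b, j ∉ B → b ∈ B →
      (f j b ≠ 0 ↔ rankMatrix v (insert j (B.erase b)) = B.card) := by
    intro j b hj hb
    rw [swap_indep hind hj hb (f j) (hf j), indep_iff, hcard j b hj hb]
  have hsupp' : ∀ j b, (if j ∉ B ∧ b ∈ B then f j b else 0) ≠ 0 ↔
      j ∉ B ∧ b ∈ B ∧ rankMatrix v (insert j (B.erase b)) = B.card := by
    intro j b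
    by_cases h : j ∉ B ∧ b ∈ B
    · rw [if_pos h, hsupp j b h.1 h.2]; tauto
    · rw [if_neg h]; simp; tauto
  refine ⟨fun j b => if j ∉ B ∧ b ∈ B then f j b else 0, ?_, hsupp', ?_⟩
  · intro j hj
    rw [hf j]
    apply Finset.sum_congr rfl
    intro x hx
    simp [hj, hx]
  · intro i l b c hil hbc h1 h2 h3 h4
    have h1' := (hsupp' _ _).1 h1
    have h2' := (hsupp' _ _).1 h2
    have h3' := (hsupp' _ _).1 h3
    have h4' := (hsupp' _ _).1 h4
    obtain ⟨hi, hb, r1⟩ := h1'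
    obtain ⟨-, hc, r2⟩ := h2'
    obtain ⟨hl, -, r3⟩ := h3'
    obtain ⟨-, -, r4⟩ := h4'
    simp only [hi, hl, hb, hc, not_false_eq_true, and_self, if_true] at h1 ⊢
    by_contra hne
    apply ht
    refine excluded_of_bad (isRk_rankMatrix v) hB hu hb hc hi hl hbc hil r1 r2 r3 r4 ?_
    have h5 := double_swap_indep hind hi hl hb hc hil hbc (f i) (f l) (hf i) (hf l) h1 hne
    rw [indep_iff] at h5
    rw [h5, Finset.card_insert_of_notMem, Finset.card_erase_add_one, hcard i b hi hb]
    · simp [hc, hbc.symm]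
    · simp [hil.symm, hl]

end Ranks

/-- Scaling, for matrices with rows in the complement of `B` and columns in `B`. -/
lemma scale_matrix {K : Type*} [Field K] (B : Finset (Fin 5)) (a a' : Fin 5 → Fin 5 → K)
    (hB : ∀ j b, a j b ≠ 0 → j ∉ B ∧ b ∈ B)
    (hs : ∀ i b, a i b = 0 ↔ a' i b = 0)
    (hm : ∀ i l b c, i ≠ l → b ≠ c → a i b ≠ 0 → a i c ≠ 0 → a l b ≠ 0 → a l c ≠ 0 →
      a i b * a l c = a i c * a l b)
    (hm' : ∀ i l b c, i ≠ l → b ≠ c → a' i b ≠ 0 → a' i c ≠ 0 → a' l b ≠ 0 → a' l c ≠ 0 →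
      a' i b * a' l c = a' i c * a' l b) :
    ∃ s t : Fin 5 → K, (∀ i, s i ≠ 0) ∧ (∀ b, t b ≠ 0) ∧
      ∀ i b, a' i b = s i * a i b * t b := by
  by_cases h2 : B.card ≤ 2
  · obtain ⟨J, hJ1, -, hJ2⟩ := Finset.exists_subsuperset_card_eq (Finset.subset_univ B) h2
      (by simp)
    obtain ⟨j, k, hjk, rfl⟩ := Finset.card_eq_two.1 hJ2
    obtain ⟨s, t, hs1, ht1, hst⟩ := scale_rows (fun b i => a i b) (fun b i => a' i b)
      (fun b i => hs i b)
      (fun i l b c h1 h2 h3 h4 h5 h6 => by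
        have := hm b c i l h2 h1 h3 h5 h4 h6
        linear_combination this)
      (fun i l b c h1 h2 h3 h4 h5 h6 => by
        have := hm' b c i l h2 h1 h3 h5 h4 h6
        linear_combination this) j k hjk
      (fun b hbj hbk i => by
        by_contra hh
        have := hJ1 (hB _ _ hh).2
        simp [hbj, hbk] at this)
    exact ⟨t, s, ht1, hs1, fun i b => by rw [hst b i]; ring⟩
  · have h3 : Bᶜ.card ≤ 2 := by
      rw [Finset.card_compl]; simp; omega
    obtain ⟨J, hJ1, -, hJ2⟩ := Finset.exists_subsuperset_card_eq (Finset.subset_univ Bᶜ) h3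
      (by simp)
    obtain ⟨j, k, hjk, rfl⟩ := Finset.card_eq_two.1 hJ2
    exact scale_rows a a' hs hm hm' j k hjk
      (fun i hij hik b => by
        by_contra hh
        have := hJ1 (Finset.mem_compl.2 (hB _ _ hh).1)
        simp [hij, hik] at this)

/-- two quintuples with the same rank matrix, whose rank type avoids the five
listed types, are in the same `GL_4`-orbit. -/
theorem sameOrbit_of_rankMatrix_eq (K : Type*) [Field K] [IsAlgClosed K] [CharZero K]
    (v w : Fin 5 → ℙ K (Fin 4 → K))
    (h : rankMatrix v = rankMatrix w)
    (ht : rankType (rankMatrix v) ∉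
      ({(4,1,0), (5,1,0), (5,5,1), (5,8,1), (5,10,1)} : Set (ℕ × ℕ × ℕ))) :
    SameOrbit v w := by
  obtain ⟨B, hB, hu⟩ := exists_basis v
  obtain ⟨a, ha, hs, hm⟩ := exists_coords v hB hu ht
  have hB' := hB
  rw [h] at hB' hu ht
  obtain ⟨a', ha', hs', hm'⟩ := exists_coords w hB' hu ht
  obtain ⟨s, t, hs0, ht0, hst⟩ := scale_matrix B a a'
    (fun j b hh => ⟨((hs j b).1 hh).1, ((hs j b).1 hh).2.1⟩)
    (fun i b => by
      rw [← not_iff_not]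
      change a i b ≠ 0 ↔ a' i b ≠ 0
      rw [hs, hs', h]) hm hm'
  have hind := (indep_iff v B).2 hB
  have hind' := (indep_iff w B).2 hB'
  have hindt : LinearIndepOn K (fun i => t i • (w i).rep) (B : Set (Fin 5)) := by
    rw [linearIndepOn_finset_iff] at hind' ⊢
    intro f hf i hi
    have := hind' (fun i => f i * t i) (by simpa only [mul_smul] using hf) i hi
    exact (mul_eq_zero.1 this).resolve_right (ht0 i)
  obtain ⟨g, hg⟩ := exists_equiv hind hindt
  refine ⟨g, fun i => ?_⟩
  have key : ∃ c : K, c • g (v i).rep = (w i).rep := by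
    by_cases hi : i ∈ B
    · exact ⟨(t i)⁻¹, by rw [hg i hi, smul_smul, inv_mul_cancel₀ (ht0 i), one_smul]⟩
    · refine ⟨s i, ?_⟩
      rw [ha i hi, ha' i hi, map_sum, Finset.smul_sum]
      apply Finset.sum_congr rfl
      intro x hx
      rw [map_smul, hg x hx, smul_smul, smul_smul, hst i x]
  conv_lhs => rw [← Projectivization.mk_rep (w i)]
  conv_rhs => rw [← Projectivization.mk_rep (v i)]
  rw [Projectivization.map_mk, Projectivization.mk_eq_mk_iff']
  exact key
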